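/- arXiv:2506.04321 — 3 statements merged into one kernel-verified Lean document; each statement's English description precedes it below -/
import Mathlib

section
/- Let β > 0 and define g₁ : ℝ → ℝ by the convolution g₁(t) = ∫_ℝ h₁(s) · h₂(t − s) ds, where h₁(s) = −1/(π β · cosh(2πs/β)) and h₂(s) = (√2/β) · exp(1/4 − 4s²/β²) · sin(2s/β). Then ∫_ℝ |g₁(t)| dt ≤ e^{1/4} / (2 √(2π)). -/
open MeasureTheory
open scoped Real

namespace Real

theorem abs_cosh_mul_inv_one_add_sinh_sq (x : ℝ) :
    |cosh x| • (1 + sinh x ^ 2)⁻¹ = (cosh x)⁻¹ := by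
  have hx := cosh_pos x
  rw [abs_of_pos hx, ← cosh_sq', smul_eq_mul]
  field_simp

theorem integrable_inv_cosh : Integrable fun x : ℝ => (cosh x)⁻¹ := by
  have h := integrableOn_image_iff_integrableOn_abs_deriv_smul MeasurableSet.univ
    (fun x _ => (hasDerivAt_sinh x).hasDerivWithinAt) sinh_injective.injOn
    (fun x : ℝ => (1 + x ^ 2)⁻¹)
  simp only [abs_cosh_mul_inv_one_add_sinh_sq, Set.image_univ, sinh_surjective.range_eq,
    integrableOn_univ] at h
  exact h.1 integrable_inv_one_add_sq

theorem integral_inv_cosh : ∫ x : ℝ, (cosh x)⁻¹ = π := by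
  have h := integral_image_eq_integral_abs_deriv_smul MeasurableSet.univ
    (fun x _ => (hasDerivAt_sinh x).hasDerivWithinAt) sinh_injective.injOn
    (fun x : ℝ => (1 + x ^ 2)⁻¹)
  simp only [abs_cosh_mul_inv_one_add_sinh_sq, Set.image_univ, sinh_surjective.range_eq,
    setIntegral_univ, integral_univ_inv_one_add_sq] at h
  exact h.symm

end Real

/-- Young's inequality in `L¹`, with pointwise majorants of the two factors. -/
theorem integral_abs_integral_mul_le_of_abs_le {f g F G : ℝ → ℝ}
    (hF : Integrable F) (hG : Integrable G)
    (hfF : ∀ s, |f s| ≤ F s) (hgG : ∀ s, |g s| ≤ G s) :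
    ∫ t : ℝ, |∫ s : ℝ, f s * g (t - s)| ≤ (∫ s, F s) * ∫ s, G s := by
  let L : ℝ →L[ℝ] ℝ →L[ℝ] ℝ := ContinuousLinearMap.mul ℝ ℝ
  calc ∫ t : ℝ, |∫ s : ℝ, f s * g (t - s)|
      ≤ ∫ t, convolution F G L volume t := by
        refine integral_mono_of_nonneg (.of_forall fun t => abs_nonneg _)
          (hF.integrable_convolution L hG) ?_
        filter_upwards [hF.ae_convolution_exists L hG] with t ht
        rw [← Real.norm_eq_abs]
        refine norm_integral_le_of_norm_le ht (.of_forall fun s => ?_)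
        rw [norm_mul]
        exact mul_le_mul (hfF s) (hgG _) (norm_nonneg _) ((abs_nonneg _).trans (hfF s))
    _ = (∫ s, F s) * ∫ s, G s := integral_convolution L hF hG

/-- For `β > 0`, the convolution kernel
`g₁(t) = ∫_ℝ h₁(s) h₂(t−s) ds` with `h₁(s) = −1/(πβ cosh(2πs/β))` and
`h₂(s) = (√2/β) exp(1/4 − 4s²/β²) sin(2s/β)` satisfies
`∫_ℝ |g₁(t)| dt ≤ e^{1/4}/(2√(2π))`. -/
theorem stmt_5 (β : ℝ) (hβ : 0 < β) (g₁ : ℝ → ℝ)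
    (hg₁ : ∀ t : ℝ, g₁ t =
      ∫ s : ℝ, (-1 / (π * β * Real.cosh (2 * π * s / β))) *
        (Real.sqrt 2 / β * Real.exp (1 / 4 - 4 * (t - s) ^ 2 / β ^ 2) *
          Real.sin (2 * (t - s) / β))) :
    ∫ t : ℝ, |g₁ t| ≤ Real.exp (1 / 4) / (2 * Real.sqrt (2 * π)) := by
  have hscale : 0 < 2 * π / β := by positivity
  have hb : 0 < 4 / β ^ 2 := by positivity
  have hF : Integrable fun s : ℝ => 1 / (π * β) * (Real.cosh (2 * π / β * s))⁻¹ :=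
    (Real.integrable_inv_cosh.comp_mul_left' hscale.ne').const_mul _
  have hG : Integrable fun s : ℝ =>
      √2 / β * Real.exp (1 / 4) * Real.exp (-(4 / β ^ 2) * s ^ 2) :=
    (integrable_exp_neg_mul_sq hb).const_mul _
  have hF_int : ∫ s : ℝ, 1 / (π * β) * (Real.cosh (2 * π / β * s))⁻¹ = 1 / (2 * π) := by
    rw [integral_const_mul, Measure.integral_comp_mul_left (fun x => (Real.cosh x)⁻¹),
      Real.integral_inv_cosh, abs_of_pos (inv_pos.2 hscale), smul_eq_mul]
    field_simp
  have hG_int : ∫ s : ℝ, √2 / β * Real.exp (1 / 4) * Real.exp (-(4 / β ^ 2) * s ^ 2) =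
      √2 * Real.exp (1 / 4) * √π / 2 := by
    have hsqrt : √(π / (4 / β ^ 2)) = √π * β / 2 := by
      rw [show π / (4 / β ^ 2) = π * (β / 2) ^ 2 by field_simp; norm_num,
        Real.sqrt_mul Real.pi_pos.le, Real.sqrt_sq (by positivity)]
      ring
    rw [integral_const_mul, integral_gaussian, hsqrt]
    field_simp
  simp_rw [hg₁]
  refine (integral_abs_integral_mul_le_of_abs_le
    (f := fun s => -1 / (π * β * Real.cosh (2 * π * s / β)))
    (g := fun u => √2 / β * Real.exp (1 / 4 - 4 * u ^ 2 / β ^ 2) * Real.sin (2 * u / β))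
    hF hG (fun s => ?_) (fun s => ?_)).trans_eq ?_
  · have hc := Real.cosh_pos (2 * π / β * s)
    rw [show 2 * π * s / β = 2 * π / β * s by ring, abs_div, abs_neg, abs_one,
      abs_of_pos (by positivity)]
    exact le_of_eq (by field_simp)
  · rw [abs_mul, abs_of_pos (by positivity), mul_assoc (√2 / β) (Real.exp (1 / 4)), ← Real.exp_add,
      show 1 / 4 + -(4 / β ^ 2) * s ^ 2 = 1 / 4 - 4 * s ^ 2 / β ^ 2 by ring]
    exact mul_le_of_le_one_right (by positivity) (Real.abs_sin_le_one _)
  · rw [hF_int, hG_int, Real.sqrt_mul zero_le_two]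
    have h2 : √2 ^ 2 = 2 := Real.sq_sqrt zero_le_two
    have hπ : √π ^ 2 = π := Real.sq_sqrt Real.pi_pos.le
    field_simp
    rw [h2, hπ]
end

section
/- Let β > 0 and define g₁ : ℝ → ℝ by the convolution g₁(t) = ∫_ℝ h₁(s) · h₂(t − s) ds, where h₁(s) = −1/(π β · cosh(2πs/β)) and h₂(s) = (√2/β) · exp(1/4 − 4s²/β²) · sin(2s/β). Then for every t₀ ≥ 0, ∫_{t₀}^∞ |g₁(t)| dt ≤ (√2 / (2 π^{3/2})) · e^{1/4} · ( e^{π²/4} · exp(−2π t₀ / β) + (1/√π) · ∫_{2t₀/β}^∞ exp(−u²) du ). -/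
open MeasureTheory
open scoped Real

/-- The hyperbolic secant is dominated by `2 * exp (-x)` on the whole line. -/
lemma one_div_cosh_le_two_mul_exp_neg (x : ℝ) : 1 / Real.cosh x ≤ 2 * Real.exp (-x) := by
  rw [div_le_iff₀ (Real.cosh_pos x), Real.cosh_eq]
  have h : Real.exp (-x) * Real.exp x = 1 := by rw [← Real.exp_add]; simp
  nlinarith [sq_nonneg (Real.exp (-x))]

/-- Pointwise domination of the integrand of the convolution by a shifted Gaussian in `s`. -/
lemma norm_sech_mul_gaussian_sin_le {β : ℝ} (hβ : 0 < β) (t s : ℝ) :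
    ‖(-1 / (π * β * Real.cosh (2 * π * s / β))) *
        (Real.sqrt 2 / β * Real.exp (1 / 4 - 4 * (t - s) ^ 2 / β ^ 2) *
          Real.sin (2 * (t - s) / β))‖ ≤
      2 * Real.sqrt 2 / (π * β ^ 2) * Real.exp (1 / 4) * Real.exp (π ^ 2 / 4) *
        Real.exp (-(2 * π / β) * t) *
          Real.exp (-(4 / β ^ 2) * (s - (t - π * β / 4)) ^ 2) := by
  have hπ := Real.pi_pos
  have hc := Real.cosh_pos (2 * π * s / β)
  have hexp : Real.exp (1 / 4) * Real.exp (π ^ 2 / 4) * Real.exp (-(2 * π / β) * t) *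
      Real.exp (-(4 / β ^ 2) * (s - (t - π * β / 4)) ^ 2) =
      Real.exp (-(2 * π * s / β)) * Real.exp (1 / 4 - 4 * (t - s) ^ 2 / β ^ 2) := by
    simp only [← Real.exp_add]
    congr 1
    field_simp
    ring
  calc _ = Real.sqrt 2 / (π * β ^ 2) * (1 / Real.cosh (2 * π * s / β)) *
        Real.exp (1 / 4 - 4 * (t - s) ^ 2 / β ^ 2) * |Real.sin (2 * (t - s) / β)| := by
        rw [Real.norm_eq_abs, abs_mul, abs_mul, abs_div, abs_neg, abs_one,
          abs_of_pos (by positivity : 0 < π * β * Real.cosh (2 * π * s / β)),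
          abs_of_pos (by positivity :
            0 < Real.sqrt 2 / β * Real.exp (1 / 4 - 4 * (t - s) ^ 2 / β ^ 2))]
        field_simp
    _ ≤ Real.sqrt 2 / (π * β ^ 2) * (2 * Real.exp (-(2 * π * s / β))) *
        Real.exp (1 / 4 - 4 * (t - s) ^ 2 / β ^ 2) * 1 := by
        gcongr
        · exact one_div_cosh_le_two_mul_exp_neg _
        · exact Real.abs_sin_le_one _
    _ = 2 * Real.sqrt 2 / (π * β ^ 2) *
        (Real.exp (-(2 * π * s / β)) * Real.exp (1 / 4 - 4 * (t - s) ^ 2 / β ^ 2)) := by ring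
    _ = _ := by rw [← hexp]; ring

/-- The convolution kernel decays exponentially. -/
lemma abs_integral_sech_mul_gaussian_sin_le {β : ℝ} (hβ : 0 < β) (t : ℝ) :
    |∫ s : ℝ, (-1 / (π * β * Real.cosh (2 * π * s / β))) *
        (Real.sqrt 2 / β * Real.exp (1 / 4 - 4 * (t - s) ^ 2 / β ^ 2) *
          Real.sin (2 * (t - s) / β))| ≤
      Real.sqrt 2 / (Real.sqrt π * β) * Real.exp (1 / 4) * Real.exp (π ^ 2 / 4) *
        Real.exp (-(2 * π / β) * t) := by
  have hπ := Real.pi_pos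
  have hint : Integrable fun s : ℝ ↦ Real.exp (-(4 / β ^ 2) * (s - (t - π * β / 4)) ^ 2) :=
    (integrable_exp_neg_mul_sq (by positivity : 0 < 4 / β ^ 2)).comp_sub_right (t - π * β / 4)
  have hval : ∫ s : ℝ, Real.exp (-(4 / β ^ 2) * (s - (t - π * β / 4)) ^ 2) =
      Real.sqrt π * β / 2 := by
    rw [integral_sub_right_eq_self (fun s : ℝ ↦ Real.exp (-(4 / β ^ 2) * s ^ 2)),
      integral_gaussian, show π / (4 / β ^ 2) = π * (β / 2) ^ 2 by field_simp; norm_num,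
      Real.sqrt_mul hπ.le, Real.sqrt_sq (by positivity)]
    ring
  refine (norm_integral_le_of_norm_le (hint.const_mul _)
    (ae_of_all _ (norm_sech_mul_gaussian_sin_le hβ t))).trans_eq ?_
  rw [integral_const_mul, hval]
  have hsq : Real.sqrt π ^ 2 = π := Real.sq_sqrt hπ.le
  field_simp
  rw [hsq]

/-- Tail bound for the convolution kernel `g₁`: for `β > 0` and every `t₀ ≥ 0`,
`∫_{t₀}^∞ |g₁(t)| dt ≤ (√2/(2π^{3/2})) e^{1/4} (e^{π²/4} e^{−2πt₀/β}
  + (1/√π) ∫_{2t₀/β}^∞ e^{−u²} du)`;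
the last term is `(1/2)·erfc(2t₀/β)` written as an explicit integral. -/
theorem stmt_7 (β : ℝ) (hβ : 0 < β) (g₁ : ℝ → ℝ)
    (hg₁ : ∀ t : ℝ, g₁ t =
      ∫ s : ℝ, (-1 / (π * β * Real.cosh (2 * π * s / β))) *
        (Real.sqrt 2 / β * Real.exp (1 / 4 - 4 * (t - s) ^ 2 / β ^ 2) *
          Real.sin (2 * (t - s) / β)))
    (t₀ : ℝ) (ht₀ : 0 ≤ t₀) :
    ∫ t in Set.Ioi t₀, |g₁ t| ≤
      (Real.sqrt 2 / (2 * π ^ ((3 : ℝ) / 2))) * Real.exp (1 / 4) *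
        (Real.exp (π ^ 2 / 4) * Real.exp (-2 * π * t₀ / β) +
          (1 / Real.sqrt π) * ∫ u in Set.Ioi (2 * t₀ / β), Real.exp (-u ^ 2)) := by
  have hπ := Real.pi_pos
  have hneg : -(2 * π / β) < 0 := neg_neg_of_pos (by positivity)
  have hpow : π ^ ((3 : ℝ) / 2) = π * Real.sqrt π := by
    rw [show (3 : ℝ) / 2 = 1 + 1 / 2 by norm_num, Real.rpow_add hπ, Real.rpow_one,
      ← Real.sqrt_eq_rpow]
  have herfc : 0 ≤ (1 / Real.sqrt π) * ∫ u in Set.Ioi (2 * t₀ / β), Real.exp (-u ^ 2) :=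
    mul_nonneg (by positivity) (integral_nonneg fun u ↦ (Real.exp_pos _).le)
  calc ∫ t in Set.Ioi t₀, |g₁ t|
      ≤ ∫ t in Set.Ioi t₀, Real.sqrt 2 / (Real.sqrt π * β) * Real.exp (1 / 4) *
          Real.exp (π ^ 2 / 4) * Real.exp (-(2 * π / β) * t) := by
        refine integral_mono_of_nonneg (ae_of_all _ fun t ↦ abs_nonneg _)
          ((integrableOn_exp_mul_Ioi hneg t₀).const_mul _) (ae_of_all _ fun t ↦ ?_)
        simp only [hg₁ t]
        exact abs_integral_sech_mul_gaussian_sin_le hβ t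
    _ = (Real.sqrt 2 / (2 * π ^ ((3 : ℝ) / 2))) * Real.exp (1 / 4) *
        (Real.exp (π ^ 2 / 4) * Real.exp (-2 * π * t₀ / β)) := by
        rw [integral_const_mul, integral_exp_mul_Ioi hneg, hpow,
          show -(2 * π / β) * t₀ = -2 * π * t₀ / β by ring]
        field_simp
    _ ≤ _ := by
        gcongr
        exact le_add_of_nonneg_right herfc
end

section
/- For every real β > 0 and every t₀ ≥ 0, the iterated integral ∫_{t₀}^∞ ∫_0^∞ exp(−2πs/β) · exp(−4(t−s)²/β²) ds dt is at most (β² / (4√π)) · e^{π²/4} · exp(−2π t₀ / β). -/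
open MeasureTheory
open scoped Real

lemma exp_mul_exp_eq_shifted_gaussian {β : ℝ} (hβ : 0 < β) (t s : ℝ) :
    Real.exp (-2 * π * s / β) * Real.exp (-4 * (t - s) ^ 2 / β ^ 2) =
      Real.exp (π ^ 2 / 4) * Real.exp (-2 * π / β * t) *
        Real.exp (-(4 / β ^ 2) * (s - (t - π * β / 4)) ^ 2) := by
  simp only [← Real.exp_add]
  congr 1
  field_simp
  ring

lemma integrable_exp_mul_exp {β : ℝ} (hβ : 0 < β) (t : ℝ) :
    Integrable fun s : ℝ ↦
      Real.exp (-2 * π * s / β) * Real.exp (-4 * (t - s) ^ 2 / β ^ 2) := by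
  simp_rw [exp_mul_exp_eq_shifted_gaussian hβ]
  have hb : 0 < 4 / β ^ 2 := by positivity
  exact ((integrable_exp_neg_mul_sq hb).comp_sub_right (t - π * β / 4)).const_mul _

lemma integral_exp_mul_exp {β : ℝ} (hβ : 0 < β) (t : ℝ) :
    ∫ s : ℝ, Real.exp (-2 * π * s / β) * Real.exp (-4 * (t - s) ^ 2 / β ^ 2) =
      Real.exp (π ^ 2 / 4) * (β * √π / 2) * Real.exp (-2 * π / β * t) := by
  simp_rw [exp_mul_exp_eq_shifted_gaussian hβ]
  rw [integral_const_mul,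
    integral_sub_right_eq_self (fun s : ℝ ↦ Real.exp (-(4 / β ^ 2) * s ^ 2)), integral_gaussian]
  have h : π / (4 / β ^ 2) = π * (β / 2) ^ 2 := by field_simp; norm_num
  rw [h, Real.sqrt_mul Real.pi_pos.le, Real.sqrt_sq (by positivity)]
  ring

/-- For every `β > 0` and `t₀ ≥ 0`, the iterated integral
`∫_{t₀}^∞ ∫_0^∞ exp(−2πs/β) exp(−4(t−s)²/β²) ds dt` is at most
`(β²/(4√π)) e^{π²/4} exp(−2πt₀/β)`. -/
theorem stmt_9 (β : ℝ) (hβ : 0 < β) (t₀ : ℝ) (ht₀ : 0 ≤ t₀) :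
    (∫ t in Set.Ioi t₀, ∫ s in Set.Ici (0 : ℝ),
        Real.exp (-2 * π * s / β) * Real.exp (-4 * (t - s) ^ 2 / β ^ 2)) ≤
      β ^ 2 / (4 * Real.sqrt π) * Real.exp (π ^ 2 / 4) * Real.exp (-2 * π * t₀ / β) := by
  have ha : -2 * π / β < 0 := div_neg_of_neg_of_pos (by linarith [Real.pi_pos]) hβ
  calc
    _ ≤ ∫ t in Set.Ioi t₀,
        Real.exp (π ^ 2 / 4) * (β * √π / 2) * Real.exp (-2 * π / β * t) := by
      refine integral_mono_of_nonneg
        (.of_forall fun t ↦ integral_nonneg fun s ↦ by positivity)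
        ((integrableOn_exp_mul_Ioi ha t₀).const_mul _) (.of_forall fun t ↦ ?_)
      dsimp only
      rw [← integral_exp_mul_exp hβ]
      exact setIntegral_le_integral (integrable_exp_mul_exp hβ t)
        (.of_forall fun s ↦ by positivity)
    _ = _ := by
      rw [integral_const_mul, integral_exp_mul_Ioi ha, mul_div_right_comm (-2 * π) t₀ β]
      have hsq : √π ^ 2 = π := Real.sq_sqrt Real.pi_pos.le
      field_simp
      rw [hsq]
      ring
end
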